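/- Consider the Reeb system (M, η, H ≡ −1) on an exact contact manifold, for which the contact Hamiltonian vector field X_{−1} equals the Reeb vector field R. If Y is a dynamical similarity of this system, i.e. [Y, R] = λ R for some λ ∈ C^∞(M), then λ = R(φ_Y), where φ_Y = −η(Y). In particular, if Y is a scaling symmetry (λ constant), then R(φ_Y) is a constant function, constant along the flow of R. -/

import Mathlib

open scoped BigOperators

/-- Vector fields on the "manifold" whose algebra of smooth functions is `R`,
modeled as ℝ-linear derivations of `R`. -/
abbrev VectorFieldOn (R : Type*) [CommRing R] [Algebra ℝ R] : Type _ := Derivation ℝ R R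

/-- The exterior derivative of a 1-form (an `R`-linear functional on vector fields),
via the intrinsic (Koszul) formula `dη(X,Y) = X(η(Y)) - Y(η(X)) - η([X,Y])`. -/
def dForm {R : Type*} [CommRing R] [Algebra ℝ R]
    (η : VectorFieldOn R →ₗ[R] R) (X Y : VectorFieldOn R) : R :=
  X (η Y) - Y (η X) - η ⁅X, Y⁆

/-- An exact contact manifold of dimension `2n+1`, described through its algebra of
smooth functions `R`: a contact form `eta`, nondegenerate and of maximal rank, with
its Reeb vector field and the contact Hamiltonian vector field assignment `ham`,
each characterized by the usual defining equations (together with uniqueness, which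
is what the contact condition `η ∧ (dη)^n ≠ 0` grants). -/
structure ExactContact (R : Type*) [CommRing R] [Algebra ℝ R] where
  n : ℕ
  eta : VectorFieldOn R →ₗ[R] R
  nondeg : ∀ Z : VectorFieldOn R, eta Z = 0 → (∀ Y, dForm eta Z Y = 0) → Z = 0
  dim_le : ∀ ω : AlternatingMap R (VectorFieldOn R) R (Fin (2 * n + 2)), ω = 0
  reeb : VectorFieldOn R
  reeb_eta : eta reeb = 1
  reeb_dEta : ∀ Y, dForm eta reeb Y = 0
  reeb_unique : ∀ Z, eta Z = 1 → (∀ Y, dForm eta Z Y = 0) → Z = reeb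
  ham : R → VectorFieldOn R
  ham_eta : ∀ f, eta (ham f) = -f
  ham_dEta : ∀ f Y, dForm eta (ham f) Y = Y f - reeb f * eta Y
  ham_unique : ∀ f Z, eta Z = -f → (∀ Y, dForm eta Z Y = Y f - reeb f * eta Y) → Z = ham f

/-- The Jacobi bracket induced by the contact form: `{f,g}_η = X_f(g) + g R(f)`. -/
def ExactContact.jacobi {R : Type*} [CommRing R] [Algebra ℝ R]
    (C : ExactContact R) (f g : R) : R :=
  C.ham f g + g * C.reeb f

/-- The Reeb system has Hamiltonian `-1`. -/
theorem ExactContact.ham_neg_one {R : Type*} [CommRing R] [Algebra ℝ R] (C : ExactContact R) :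
    C.ham (-1 : R) = C.reeb :=
  (C.ham_unique (-1) C.reeb (by simp [C.reeb_eta]) fun Y => by simp [C.reeb_dEta Y]).symm

/-- The contact form is invariant under the Reeb flow, whence `η([Y, R]) = R(-η(Y))`. -/
theorem ExactContact.eta_lie_reeb {R : Type*} [CommRing R] [Algebra ℝ R]
    (C : ExactContact R) (Y : VectorFieldOn R) :
    C.eta ⁅Y, C.reeb⁆ = C.reeb (-C.eta Y) := by
  have h := C.reeb_dEta Y
  simp only [dForm, C.reeb_eta, Derivation.map_one_eq_zero, sub_zero] at h
  rw [← lie_skew, map_neg, map_neg, sub_eq_zero.mp h]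

/-- for the Reeb system `(M,η,-1)` one has `X_{-1} = R`; if `Y` is a
dynamical similarity, `[Y,R] = λ R`, then `λ = R(φ_Y)` with `φ_Y = -η(Y)`; in
particular if `λ` is constant then `R(φ_Y)` is constant along the flow of `R`. -/
theorem reeb_system_dynamical_similarity {R : Type*} [CommRing R] [Algebra ℝ R]
    (C : ExactContact R) (Y : VectorFieldOn R) (lam : R)
    (hY : ⁅Y, C.reeb⁆ = lam • C.reeb) :
    C.ham (-1 : R) = C.reeb ∧
      lam = C.reeb (-C.eta Y) ∧
      (∀ c : ℝ, lam = algebraMap ℝ R c → C.reeb (C.reeb (-C.eta Y)) = 0) := by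
  have hlam : lam = C.reeb (-C.eta Y) := by
    rw [← C.eta_lie_reeb, hY, map_smul, C.reeb_eta, smul_eq_mul, mul_one]
  refine ⟨C.ham_neg_one, hlam, fun c hc => ?_⟩
  rw [← hlam, hc, Derivation.map_algebraMap]
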